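/- Let (W,S) be a Coxeter system, J ⊆ S with W_J finite with longest element w₀(J). Then for any reduced expression w₀(J) = s₁⋯s_k, the composition P^{{s₁}} ∘ ⋯ ∘ P^{{s_k}} equals the parabolic projection P^J : W → W, w ↦ w^J. -/

import Mathlib

open CoxeterSystem

variable {B W : Type*} [Group W] {M : CoxeterMatrix B}

/-- The projection `P^{{s}}` onto `W^{{s}}`: removes a trailing `s` if that shortens `w`. -/
noncomputable def CoxeterSystem.projSimple (cs : CoxeterSystem M W) (s : B) (w : W) : W :=
  if cs.length (w * cs.simple s) < cs.length w then w * cs.simple s else w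

/-- For a word `ω = s₁ ⋯ s_k`, the composition `P^{{s₁}} ∘ ⋯ ∘ P^{{s_k}}`. -/
noncomputable def CoxeterSystem.projWord (cs : CoxeterSystem M W) (ω : List B) : W → W :=
  ω.foldr (fun s g => cs.projSimple s ∘ g) id

/-- The Bruhat order, via the subword property: `u ≤ v` iff some reduced word for `v`
has a subword whose product is `u`. -/
def CoxeterSystem.bruhatLE (cs : CoxeterSystem M W) (u v : W) : Prop :=
  ∃ ω : List B, cs.IsReduced ω ∧ cs.wordProd ω = v ∧
    ∃ ω' : List B, ω'.Sublist ω ∧ cs.wordProd ω' = u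

/-- The standard parabolic subgroup `W_J`. -/
def CoxeterSystem.parabolic (cs : CoxeterSystem M W) (J : Set B) : Subgroup W :=
  Subgroup.closure (cs.simple '' J)

/-- The set of minimal-length left coset representatives `W^J`. -/
def CoxeterSystem.minReps (cs : CoxeterSystem M W) (J : Set B) : Set W :=
  {w : W | ∀ s ∈ J, cs.length w < cs.length (w * cs.simple s)}

/-- `P` is the family of parabolic projections `P^J : W → W`, `w ↦ w^J`. -/
def CoxeterSystem.IsProjFamily (cs : CoxeterSystem M W) (P : Set B → W → W) : Prop :=
  ∀ (J : Set B) (w : W), P J w ∈ cs.minReps J ∧ (P J w)⁻¹ * w ∈ cs.parabolic J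

namespace CoxeterSystem

/-! ### The exchange property -/

theorem _root_.Function.End.mul_apply_eq {α : Type*} (f g : Function.End α) (a : α) :
    (f * g) a = f (g a) :=
  rfl

open Classical in
/-- The action of a simple reflection on `W × ZMod 2` that conjugates the first coordinate and
flips the second one exactly at the simple reflection itself. -/
noncomputable def signedConj (cs : CoxeterSystem M W) (i : B) : Function.End (W × ZMod 2) :=
  fun p => (cs.simple i * p.1 * cs.simple i, p.2 + if p.1 = cs.simple i then 1 else 0)

open Classical in
theorem signedConj_mul_pow_apply (cs : CoxeterSystem M W) (i j : B) (n : ℕ) (t : W) (e : ZMod 2) :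
    ((cs.signedConj i * cs.signedConj j) ^ n) (t, e) =
      ((cs.simple i * cs.simple j) ^ n * t * ((cs.simple i * cs.simple j) ^ n)⁻¹,
        e + ∑ k ∈ Finset.range (2 * n),
          if t = cs.simple j * (cs.simple i * cs.simple j) ^ k then 1 else 0) := by
  induction n with
  | zero => simp; rfl
  | succ n ih =>
    set c := cs.simple i * cs.simple j with hc
    have hji : cs.simple j * cs.simple i = c⁻¹ := by simp [hc]
    have hconj : ∀ k : ℕ, cs.simple j * c ^ k * cs.simple j = (c ^ k)⁻¹ := by
      intro k
      have h := conj_pow (i := k) (a := cs.simple j) (b := c)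
      rw [cs.inv_simple] at h
      rw [← h, ← mul_assoc, hji, mul_assoc, cs.simple_mul_simple_self, mul_one, inv_pow]
    have hcomm : ∀ k : ℕ, cs.simple j * c ^ k = (c ^ k)⁻¹ * cs.simple j := by
      intro k
      rw [← hconj k, mul_assoc _ (cs.simple j) (cs.simple j), cs.simple_mul_simple_self, mul_one]
    have h₁ : (c ^ n * t * (c ^ n)⁻¹ = cs.simple j) ↔ t = cs.simple j * c ^ (2 * n) := by
      rw [two_mul, pow_add, ← mul_assoc, hcomm n, mul_inv_eq_iff_eq_mul, mul_assoc _ _ (c ^ n),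
        eq_inv_mul_iff_mul_eq]
    have h₂ : (cs.simple j * (c ^ n * t * (c ^ n)⁻¹) * cs.simple j = cs.simple i) ↔
        t = cs.simple j * c ^ (2 * n + 1) := by
      have e₁ : cs.simple j * c ^ (2 * n + 1) = (c ^ n)⁻¹ * (cs.simple j * c) * c ^ n := by
        rw [show 2 * n + 1 = n + (1 + n) by ring, pow_add, ← mul_assoc, hcomm n, pow_add,
          pow_one]
        simp only [mul_assoc]
      have e₂ : cs.simple j * c * cs.simple j = c⁻¹ := by simpa using hconj 1
      rw [e₁]
      constructor
      · intro h
        have h' : c ^ n * t * (c ^ n)⁻¹ = cs.simple j * cs.simple i * cs.simple j := by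
          rw [← h]; simp [mul_assoc]
        have h'' : cs.simple j * c = cs.simple j * cs.simple i * cs.simple j := by
          simp [hc, mul_assoc]
        rw [h'', ← h']; group
      · intro h
        rw [h]
        have : c ^ n * ((c ^ n)⁻¹ * (cs.simple j * c) * c ^ n) * (c ^ n)⁻¹ = cs.simple j * c := by
          group
        rw [this]; simp [hc, mul_assoc]
    rw [pow_succ', Function.End.mul_apply_eq, ih]
    simp only [signedConj, Function.End.mul_apply_eq]
    refine Prod.ext ?_ ?_
    · rw [pow_succ' c n, mul_inv_rev, ← hji]
      simp only [hc, mul_assoc]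
    · simp only [h₁, h₂]
      rw [show 2 * (n + 1) = 2 * n + 1 + 1 by ring, Finset.sum_range_succ, Finset.sum_range_succ]
      simp only [add_assoc]

theorem isLiftable_signedConj (cs : CoxeterSystem M W) : M.IsLiftable cs.signedConj := by
  classical
  intro i j
  funext ⟨t, e⟩
  rw [signedConj_mul_pow_apply, cs.simple_mul_simple_pow, two_mul, Finset.sum_range_add]
  simp only [pow_add, cs.simple_mul_simple_pow, one_mul, CharTwo.add_self_eq_zero]
  simp
  rfl

open Classical in
theorem lift_signedConj_wordProd (cs : CoxeterSystem M W) (ω : List B) (t : W) (e : ZMod 2) :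
    cs.lift ⟨_, cs.isLiftable_signedConj⟩ (cs.wordProd ω) (t, e) =
      (cs.wordProd ω * t * (cs.wordProd ω)⁻¹, e + ((cs.rightInvSeq ω).count t : ZMod 2)) := by
  induction ω with
  | nil => simp; rfl
  | cons i ω ih =>
    rw [wordProd_cons, map_mul, Function.End.mul_apply_eq, ih, lift_apply_simple]
    refine Prod.ext ?_ ?_
    · simp [signedConj, mul_assoc]
    · have h : (cs.wordProd ω * t * (cs.wordProd ω)⁻¹ = cs.simple i) ↔
          (cs.wordProd ω)⁻¹ * cs.simple i * cs.wordProd ω = t := by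
        rw [mul_inv_eq_iff_eq_mul, mul_assoc, inv_mul_eq_iff_eq_mul, eq_comm]
      simp only [signedConj, h, rightInvSeq, List.count_cons, beq_iff_eq]
      push_cast
      rw [add_assoc]

/-- The exchange property, for not necessarily reduced words. -/
theorem exists_wordProd_mul_simple_eq_eraseIdx (cs : CoxeterSystem M W) {ω : List B} {i : B}
    (h : cs.length (cs.wordProd ω * cs.simple i) < cs.length (cs.wordProd ω)) :
    ∃ j < ω.length, cs.wordProd ω * cs.simple i = cs.wordProd (ω.eraseIdx j) := by
  classical
  obtain ⟨τ, hτ, hτω⟩ := cs.exists_isReduced (cs.wordProd ω * cs.simple i)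
  have hprod : cs.wordProd (τ.concat i) = cs.wordProd ω := by
    rw [wordProd_concat, ← hτω, simple_mul_simple_cancel_right]
  have hred : cs.IsReduced (τ.concat i) := by
    have h₁ := cs.isRightDescent_iff.mp h
    rw [IsReduced, hprod, List.length_concat, ← h₁, hτω, hτ.eq]
  have hcount : (cs.rightInvSeq (τ.concat i)).count (cs.simple i) = 1 :=
    List.count_eq_one_of_mem hred.nodup_rightInvSeq (by rw [rightInvSeq_concat]; simp)
  have hcast : ((cs.rightInvSeq ω).count (cs.simple i) : ZMod 2) = 1 := by
    have h₁ := cs.lift_signedConj_wordProd (τ.concat i) (cs.simple i) 0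
    rw [hprod, lift_signedConj_wordProd, hcount] at h₁
    simpa using congrArg Prod.snd h₁
  have hmem : cs.simple i ∈ cs.rightInvSeq ω := by
    by_contra hn
    rw [List.count_eq_zero_of_not_mem hn] at hcast
    simp at hcast
  obtain ⟨j, hj, hji⟩ := List.mem_iff_getElem.mp hmem
  refine ⟨j, by simpa using hj, ?_⟩
  rw [← wordProd_mul_getD_rightInvSeq, List.getD_eq_getElem _ _ hj, hji]

theorem length_wordProd_eraseIdx_lt (cs : CoxeterSystem M W) {ω : List B} {j : ℕ}
    (hj : j < ω.length) : cs.length (cs.wordProd (ω.eraseIdx j)) < ω.length := by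
  have h₁ := cs.length_wordProd_le (ω.eraseIdx j)
  have h₂ := List.length_eraseIdx_add_one hj
  omega

/-- The exchange property for a product of two words, the second one staying reduced after
appending the letter: the exchanged letter lies in the first word. -/
theorem exists_wordProd_mul_eq_eraseIdx_mul (cs : CoxeterSystem M W) {ω τ : List B} {i : B}
    (hτ : cs.IsReduced (τ ++ [i]))
    (h : cs.length (cs.wordProd (ω ++ τ) * cs.simple i) < cs.length (cs.wordProd (ω ++ τ))) :
    ∃ j < ω.length, cs.wordProd (ω ++ τ) * cs.simple i =
      cs.wordProd (ω.eraseIdx j) * cs.wordProd τ := by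
  obtain ⟨j, hj, hji⟩ := cs.exists_wordProd_mul_simple_eq_eraseIdx h
  rcases lt_or_ge j ω.length with hlt | hge
  · exact ⟨j, hlt, by rw [hji, List.eraseIdx_append_of_lt_length hlt, wordProd_append]⟩
  · rw [List.eraseIdx_append_of_length_le hge, wordProd_append, wordProd_append, mul_assoc,
      mul_left_cancel_iff] at hji
    have h₁ := hτ.eq
    rw [List.length_append] at hj
    have h₂ := cs.length_wordProd_eraseIdx_lt (ω := τ) (j := j - ω.length) (by omega)
    rw [wordProd_append, wordProd_singleton, hji, List.length_append] at h₁
    omega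

theorem IsReduced.of_append_left {cs : CoxeterSystem M W} {ω τ : List B}
    (h : cs.IsReduced (ω ++ τ)) : cs.IsReduced ω := by
  simpa using h.take ω.length

/-! ### Standard parabolic subgroups -/

theorem simple_mem_parabolic (cs : CoxeterSystem M W) {J : Set B} {i : B} (hi : i ∈ J) :
    cs.simple i ∈ cs.parabolic J :=
  Subgroup.subset_closure ⟨i, hi, rfl⟩

theorem wordProd_mem_parabolic (cs : CoxeterSystem M W) {J : Set B} {ω : List B}
    (h : ∀ i ∈ ω, i ∈ J) : cs.wordProd ω ∈ cs.parabolic J := by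
  refine Subgroup.list_prod_mem _ fun x hx => ?_
  obtain ⟨i, hi, rfl⟩ := List.mem_map.mp hx
  exact cs.simple_mem_parabolic (h i hi)

theorem exists_isReduced_of_mem_parabolic (cs : CoxeterSystem M W) {J : Set B} {u : W}
    (hu : u ∈ cs.parabolic J) :
    ∃ ω : List B, cs.IsReduced ω ∧ (∀ i ∈ ω, i ∈ J) ∧ cs.wordProd ω = u := by
  have step : ∀ (x : W) (i : B), i ∈ J →
      (∃ ω : List B, cs.IsReduced ω ∧ (∀ i ∈ ω, i ∈ J) ∧ cs.wordProd ω = x) →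
      ∃ ω : List B, cs.IsReduced ω ∧ (∀ i ∈ ω, i ∈ J) ∧ cs.wordProd ω = x * cs.simple i := by
    rintro _ i hi ⟨ω, hω, hωJ, rfl⟩
    rcases cs.length_mul_simple (cs.wordProd ω) i with h | h
    · refine ⟨ω ++ [i], ?_, ?_, by rw [wordProd_append, wordProd_singleton]⟩
      · rw [IsReduced, wordProd_append, wordProd_singleton, h, hω.eq]; simp
      · intro k hk
        rcases List.mem_append.mp hk with hk | hk
        · exact hωJ k hk
        · rwa [List.mem_singleton.mp hk]
    · obtain ⟨j, hj, hji⟩ := cs.exists_wordProd_mul_simple_eq_eraseIdx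
        (ω := ω) (i := i) (by omega)
      refine ⟨ω.eraseIdx j, ?_, fun k hk => hωJ k (List.mem_of_mem_eraseIdx hk), hji.symm⟩
      have h₁ := List.length_eraseIdx_add_one hj
      have h₂ := hω.eq
      rw [IsReduced, ← hji]
      omega
  refine Subgroup.closure_induction_right (p := fun u _ => ∃ ω : List B, cs.IsReduced ω ∧
    (∀ i ∈ ω, i ∈ J) ∧ cs.wordProd ω = u) ⟨[], by simp [IsReduced]⟩ ?_ ?_ hu
  · rintro x _ _ ⟨i, hi, rfl⟩ h
    exact step x i hi h
  · rintro x _ _ ⟨i, hi, rfl⟩ h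
    rw [inv_simple]
    exact step x i hi h

theorem simple_mem_parabolic_of_isReduced (cs : CoxeterSystem M W) {J : Set B} {ω : List B}
    (hω : cs.IsReduced ω) (h : cs.wordProd ω ∈ cs.parabolic J) :
    ∀ i ∈ ω, cs.simple i ∈ cs.parabolic J := by
  induction ω using List.reverseRecOn with
  | nil => simp
  | append_singleton ω i ih =>
    have hω' := hω.of_append_left
    have hi : cs.simple i ∈ cs.parabolic J := by
      obtain ⟨τ, -, hτJ, hτ⟩ := cs.exists_isReduced_of_mem_parabolic h
      have hlt : cs.length (cs.wordProd τ * cs.simple i) < cs.length (cs.wordProd τ) := by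
        rw [hτ, hω.eq, wordProd_append, wordProd_singleton, simple_mul_simple_cancel_right,
          hω'.eq]
        simp
      obtain ⟨j, -, hj⟩ := cs.exists_wordProd_mul_simple_eq_eraseIdx hlt
      rw [← Subgroup.mul_mem_cancel_left _ h, ← hτ, hj]
      exact cs.wordProd_mem_parabolic fun k hk => hτJ k (List.mem_of_mem_eraseIdx hk)
    rw [wordProd_append, wordProd_singleton, Subgroup.mul_mem_cancel_right _ hi] at h
    intro k hk
    rcases List.mem_append.mp hk with hk | hk
    · exact ih hω' h k hk
    · rwa [List.mem_singleton.mp hk]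

theorem length_mul_of_forall_length_le (cs : CoxeterSystem M W) {J : Set B} {x : W}
    (hx : ∀ u ∈ cs.parabolic J, cs.length x ≤ cs.length (x * u)) {u : W}
    (hu : u ∈ cs.parabolic J) : cs.length (x * u) = cs.length x + cs.length u := by
  obtain ⟨τ, hτ, hτJ, rfl⟩ := cs.exists_isReduced_of_mem_parabolic hu
  clear hu
  rw [hτ.eq]
  induction τ using List.reverseRecOn with
  | nil => simp
  | append_singleton τ i ih =>
    have ih := ih hτ.of_append_left fun k hk => hτJ k (by simp [hk])
    obtain ⟨ω, hω, rfl⟩ := cs.exists_isReduced x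
    rw [wordProd_append, wordProd_singleton, ← mul_assoc]
    rcases cs.length_mul_simple (cs.wordProd ω * cs.wordProd τ) i with h | h
    · rw [h, ih, List.length_append, List.length_singleton, add_assoc]
    · obtain ⟨j, hj, hji⟩ := cs.exists_wordProd_mul_eq_eraseIdx_mul (ω := ω) hτ
        (by rw [wordProd_append]; omega)
      have hmem : cs.wordProd τ * cs.simple i * (cs.wordProd τ)⁻¹ ∈ cs.parabolic J := by
        have hτm : cs.wordProd τ ∈ cs.parabolic J :=
          cs.wordProd_mem_parabolic fun k hk => hτJ k (by simp [hk])
        exact mul_mem (mul_mem hτm (cs.simple_mem_parabolic (hτJ i (by simp)))) (inv_mem hτm)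
      have h₁ := hx _ hmem
      rw [wordProd_append] at hji
      rw [← mul_assoc, ← mul_assoc, hji, mul_inv_cancel_right, hω.eq] at h₁
      exact absurd (cs.length_wordProd_eraseIdx_lt hj) (by omega)

theorem length_le_length_mul_of_mem_minReps (cs : CoxeterSystem M W) {J : Set B} {x : W}
    (hx : x ∈ cs.minReps J) {u : W} (hu : u ∈ cs.parabolic J) :
    cs.length x ≤ cs.length (x * u) := by
  obtain ⟨v, hv⟩ := exists_minimalFor_of_wellFoundedLT
    (fun v : W => v ∈ cs.parabolic J) (fun v => cs.length (x * v)) ⟨1, one_mem _⟩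
  have hmin : ∀ u ∈ cs.parabolic J, cs.length (x * v) ≤ cs.length (x * u) :=
    fun u hu => (le_total _ _).elim id (fun h => hv.2 hu h)
  have hadd : ∀ u ∈ cs.parabolic J,
      cs.length (x * v * u) = cs.length (x * v) + cs.length u := fun u hu =>
    cs.length_mul_of_forall_length_le
      (fun u hu => by rw [mul_assoc]; exact hmin _ (mul_mem hv.1 hu)) hu
  obtain ⟨τ, hτ, hτJ, hτv⟩ := cs.exists_isReduced_of_mem_parabolic (inv_mem hv.1)
  rcases List.eq_nil_or_concat τ with rfl | ⟨τ, i, rfl⟩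
  · rw [wordProd_nil, eq_comm, inv_eq_one] at hτv
    simpa [hτv] using hmin u hu
  · rw [List.concat_eq_append] at hτ hτJ hτv
    have hi : i ∈ J := hτJ i (by simp)
    have h₁ := hadd _ (inv_mem hv.1)
    have h₂ := hadd _ (mul_mem (inv_mem hv.1) (cs.simple_mem_parabolic hi))
    rw [← hτv, hτ.eq, hτv, mul_inv_cancel_right] at h₁
    rw [← mul_assoc, mul_inv_cancel_right, ← hτv, wordProd_append, wordProd_singleton,
      simple_mul_simple_cancel_right, hτ.of_append_left.eq] at h₂
    have h₃ := hx i hi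
    rw [List.length_append] at h₁
    omega

theorem length_mul_of_mem_minReps (cs : CoxeterSystem M W) {J : Set B} {x u : W}
    (hx : x ∈ cs.minReps J) (hu : u ∈ cs.parabolic J) :
    cs.length (x * u) = cs.length x + cs.length u :=
  cs.length_mul_of_forall_length_le
    (fun _ hv => cs.length_le_length_mul_of_mem_minReps hx hv) hu

/-- Every element of `W_J` is a suffix of the longest element of `W_J`. -/
theorem exists_wordProd_mul_eq_longest (cs : CoxeterSystem M W) {J : Set B} {w₀ : W}
    (hmem : w₀ ∈ cs.parabolic J) (hmax : ∀ u ∈ cs.parabolic J, cs.length u ≤ cs.length w₀)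
    {u : W} (hu : u ∈ cs.parabolic J) :
    ∃ b : List B, cs.wordProd b * u = w₀ ∧ cs.length w₀ = b.length + cs.length u := by
  obtain ⟨τ, hτ, hτJ, rfl⟩ := cs.exists_isReduced_of_mem_parabolic hu
  clear hu
  rw [hτ.eq]
  induction τ using List.reverseRecOn with
  | nil =>
    obtain ⟨ω, hω, rfl⟩ := cs.exists_isReduced w₀
    exact ⟨ω, by simp, by simp [hω.eq]⟩
  | append_singleton τ i ih =>
    obtain ⟨b, rfl, hlen⟩ := ih hτ.of_append_left fun k hk => hτJ k (by simp [hk])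
    have hle := hmax _ (mul_mem hmem (cs.simple_mem_parabolic (hτJ i (by simp))))
    obtain ⟨j, hj, hji⟩ := cs.exists_wordProd_mul_eq_eraseIdx_mul (ω := b) hτ
      (by rw [wordProd_append]; exact lt_of_le_of_ne hle (cs.length_mul_simple_ne _ _))
    refine ⟨b.eraseIdx j, ?_, ?_⟩
    · rw [wordProd_append, wordProd_singleton, ← mul_assoc, ← hji, wordProd_append,
        simple_mul_simple_cancel_right]
    · have := List.length_eraseIdx_add_one hj
      rw [List.length_append, List.length_singleton]
      omega

/-! ### Compositions of simple projections -/

theorem projSimple_of_lt (cs : CoxeterSystem M W) {s : B} {w : W}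
    (h : cs.length (w * cs.simple s) < cs.length w) :
    cs.projSimple s w = w * cs.simple s :=
  if_pos h

theorem projSimple_of_not_lt (cs : CoxeterSystem M W) {s : B} {w : W}
    (h : ¬cs.length (w * cs.simple s) < cs.length w) : cs.projSimple s w = w :=
  if_neg h

theorem projSimple_simple_mul (cs : CoxeterSystem M W) (s t : B) {u : W}
    (h : cs.length u < cs.length (cs.simple t * u)) :
    cs.projSimple s (cs.simple t * u) = cs.projSimple s u ∨
      cs.projSimple s (cs.simple t * u) = cs.simple t * cs.projSimple s u ∧
      cs.length (cs.simple t * cs.projSimple s u) = cs.length (cs.projSimple s u) + 1 := by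
  have htu := cs.length_simple_mul u t
  have htus := cs.length_simple_mul (u * cs.simple s) t
  have htus' := cs.length_mul_simple (cs.simple t * u) s
  have hus' := cs.length_mul_simple u s
  rw [mul_assoc] at htus'
  by_cases hus : cs.length (u * cs.simple s) < cs.length u
  · have hlt : cs.length (cs.simple t * u * cs.simple s) < cs.length (cs.simple t * u) := by
      rw [mul_assoc]; omega
    rw [cs.projSimple_of_lt hus, cs.projSimple_of_lt hlt, mul_assoc]
    exact Or.inr ⟨rfl, by omega⟩
  · rw [cs.projSimple_of_not_lt hus]
    by_cases hlt : cs.length (cs.simple t * u * cs.simple s) < cs.length (cs.simple t * u)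
    · left
      rw [cs.projSimple_of_lt hlt]
      obtain ⟨ω, hω, rfl⟩ := cs.exists_isReduced u
      rw [← wordProd_cons] at hlt ⊢
      obtain ⟨j, hj, hji⟩ := cs.exists_wordProd_mul_simple_eq_eraseIdx hlt
      rw [hji]
      cases j with
      | zero => rfl
      | succ j =>
        rw [List.eraseIdx_cons_succ, wordProd_cons, wordProd_cons, mul_assoc,
          mul_left_cancel_iff] at hji
        rw [hji, hω.eq] at hus
        exact absurd (cs.length_wordProd_eraseIdx_lt (by simpa using hj)) hus
    · rw [cs.projSimple_of_not_lt hlt]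
      exact Or.inr ⟨rfl, by omega⟩

/-- Simple projections are monotone for the left weak order. -/
theorem exists_projSimple_wordProd_mul (cs : CoxeterSystem M W) (s : B) {b : List B} {u : W}
    (h : cs.length (cs.wordProd b * u) = b.length + cs.length u) :
    ∃ b' : List B, cs.projSimple s (cs.wordProd b * u) = cs.wordProd b' * cs.projSimple s u ∧
      cs.length (cs.wordProd b' * cs.projSimple s u) =
        b'.length + cs.length (cs.projSimple s u) := by
  induction b with
  | nil => exact ⟨[], by simp⟩
  | cons t b ih =>
    rw [wordProd_cons, mul_assoc, List.length_cons] at h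
    have h₁ := cs.length_mul_le (cs.wordProd b) u
    have h₂ := cs.length_wordProd_le b
    have h₃ := cs.length_simple_mul (cs.wordProd b * u) t
    obtain ⟨b', hb', hlen⟩ := ih (by omega)
    rcases cs.projSimple_simple_mul s t (u := cs.wordProd b * u) (by omega) with h₄ | ⟨h₄, h₅⟩
    · exact ⟨b', by rw [wordProd_cons, mul_assoc, h₄, hb'], hlen⟩
    · rw [hb', ← mul_assoc, ← wordProd_cons] at h₅
      refine ⟨t :: b', by rw [wordProd_cons, mul_assoc, h₄, hb', wordProd_cons, mul_assoc], ?_⟩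
      rw [h₅, hlen, List.length_cons]
      omega

theorem projWord_cons (cs : CoxeterSystem M W) (s : B) (ω : List B) (w : W) :
    cs.projWord (s :: ω) w = cs.projSimple s (cs.projWord ω w) :=
  rfl

theorem projWord_append (cs : CoxeterSystem M W) (ω τ : List B) (w : W) :
    cs.projWord (ω ++ τ) w = cs.projWord ω (cs.projWord τ w) := by
  induction ω with
  | nil => rfl
  | cons s ω ih => rw [List.cons_append, projWord_cons, projWord_cons, ih]

theorem exists_projWord_wordProd_mul (cs : CoxeterSystem M W) (ω : List B) {b : List B} {u : W}
    (h : cs.length (cs.wordProd b * u) = b.length + cs.length u) :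
    ∃ b' : List B, cs.projWord ω (cs.wordProd b * u) = cs.wordProd b' * cs.projWord ω u ∧
      cs.length (cs.wordProd b' * cs.projWord ω u) =
        b'.length + cs.length (cs.projWord ω u) := by
  induction ω with
  | nil => exact ⟨b, rfl, h⟩
  | cons s ω ih =>
    obtain ⟨b', hb', hlen⟩ := ih
    simp only [projWord_cons, hb']
    exact cs.exists_projSimple_wordProd_mul s hlen

theorem IsReduced.projWord_wordProd {cs : CoxeterSystem M W} {ω : List B}
    (hω : cs.IsReduced ω) : cs.projWord ω (cs.wordProd ω) = 1 := by
  induction ω using List.reverseRecOn with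
  | nil => exact cs.wordProd_nil
  | append_singleton ω i ih =>
    have hlt : cs.length (cs.wordProd (ω ++ [i]) * cs.simple i) <
        cs.length (cs.wordProd (ω ++ [i])) := by
      rw [hω.eq, wordProd_append, wordProd_singleton, simple_mul_simple_cancel_right,
        hω.of_append_left.eq]
      simp
    have h : cs.projWord [i] (cs.wordProd (ω ++ [i])) = cs.wordProd ω := by
      change cs.projSimple i (cs.wordProd (ω ++ [i])) = _
      rw [cs.projSimple_of_lt hlt, wordProd_append, wordProd_singleton,
        simple_mul_simple_cancel_right]
    rw [projWord_append, h, ih hω.of_append_left]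

theorem projWord_eq_one_of_mem_parabolic (cs : CoxeterSystem M W) {J : Set B} {ω : List B}
    (hω : cs.IsReduced ω) (hmem : cs.wordProd ω ∈ cs.parabolic J)
    (hmax : ∀ u ∈ cs.parabolic J, cs.length u ≤ cs.length (cs.wordProd ω))
    {u : W} (hu : u ∈ cs.parabolic J) : cs.projWord ω u = 1 := by
  obtain ⟨b, hb, hlen⟩ := cs.exists_wordProd_mul_eq_longest hmem hmax hu
  obtain ⟨b', hb', hlen'⟩ := cs.exists_projWord_wordProd_mul ω (b := b) (u := u) (by rw [hb, hlen])
  rw [← hb', hb, hω.projWord_wordProd, length_one] at hlen'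
  exact cs.length_eq_zero_iff.mp (by omega)

theorem projSimple_mem_parabolic (cs : CoxeterSystem M W) {J : Set B} {s : B} {u : W}
    (hs : cs.simple s ∈ cs.parabolic J) (hu : u ∈ cs.parabolic J) :
    cs.projSimple s u ∈ cs.parabolic J := by
  unfold projSimple
  split_ifs
  exacts [mul_mem hu hs, hu]

theorem projWord_mem_parabolic (cs : CoxeterSystem M W) {J : Set B} {ω : List B} {u : W}
    (hω : ∀ s ∈ ω, cs.simple s ∈ cs.parabolic J) (hu : u ∈ cs.parabolic J) :
    cs.projWord ω u ∈ cs.parabolic J := by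
  induction ω with
  | nil => exact hu
  | cons s ω ih =>
    exact cs.projSimple_mem_parabolic (hω s (by simp)) (ih fun t ht => hω t (by simp [ht]))

theorem projSimple_mul_of_mem_minReps (cs : CoxeterSystem M W) {J : Set B} {s : B} {x u : W}
    (hx : x ∈ cs.minReps J) (hs : cs.simple s ∈ cs.parabolic J) (hu : u ∈ cs.parabolic J) :
    cs.projSimple s (x * u) = x * cs.projSimple s u := by
  simp only [projSimple, mul_assoc, cs.length_mul_of_mem_minReps hx hu,
    cs.length_mul_of_mem_minReps hx (mul_mem hu hs), add_lt_add_iff_left, mul_ite]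

theorem projWord_mul_of_mem_minReps (cs : CoxeterSystem M W) {J : Set B} {ω : List B} {x u : W}
    (hx : x ∈ cs.minReps J) (hω : ∀ s ∈ ω, cs.simple s ∈ cs.parabolic J)
    (hu : u ∈ cs.parabolic J) : cs.projWord ω (x * u) = x * cs.projWord ω u := by
  induction ω with
  | nil => rfl
  | cons s ω ih =>
    have hω' : ∀ t ∈ ω, cs.simple t ∈ cs.parabolic J := fun t ht => hω t (by simp [ht])
    rw [projWord_cons, projWord_cons, ih hω', cs.projSimple_mul_of_mem_minReps hx
      (hω s (by simp)) (cs.projWord_mem_parabolic hω' hu)]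

end CoxeterSystem

theorem stmt_9 (cs : CoxeterSystem M W) (P : Set B → W → W) (hP : cs.IsProjFamily P)
    (J : Set B) (w₀J : W) (hmem : w₀J ∈ cs.parabolic J)
    (hmax : ∀ u ∈ cs.parabolic J, cs.length u ≤ cs.length w₀J)
    (ω : List B) (hred : cs.IsReduced ω) (hprod : cs.wordProd ω = w₀J) (w : W) :
    cs.projWord ω w = P J w := by
  subst hprod
  obtain ⟨hx, hu⟩ := hP J w
  have h := cs.projWord_mul_of_mem_minReps hx (cs.simple_mem_parabolic_of_isReduced hred hmem) hu
  rwa [mul_inv_cancel_left, cs.projWord_eq_one_of_mem_parabolic hred hmem hmax hu, mul_one] at h
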